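/- arXiv:2202.12945 — 2 statements merged into one kernel-verified Lean document; each statement's English description precedes it below -/
import Mathlib

section
/- Let X be a real Banach algebra with identity satisfying the sequential condition (P), and let S be a nonempty, bounded, closed and convex subset of X. Let A, B, C : S → X be weakly sequentially continuous operators such that: (i) A x is invertible in X for every x ∈ S; (ii) A(S) and B(S) are relatively weakly compact; (iii) for every sequence (x_n) in S such that (x_n − C x_n) converges weakly, the sequence (x_n) has a weakly convergent subsequence; (iv) for every y ∈ S there exists a unique x ∈ S with x = A x · B y + C x. Then there exists x ∈ S with x = A x · B x + C x. -/
open Filter Topology Pointwise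

variable {X : Type*} [NormedAddCommGroup X] [NormedSpace ℝ X]

/-- `u` converges weakly to `x`. -/
def WeakConv (u : ℕ → X) (x : X) : Prop :=
  ∀ f : X →L[ℝ] ℝ, Tendsto (fun n => f (u n)) atTop (𝓝 (f x))

/-- A set is weakly compact if it is compact in the weak topology `σ(X, X*)`. -/
def WeaklyCompact (K : Set X) : Prop :=
  IsCompact (toWeakSpace ℝ X '' K)

/-- The closure of a set in the weak topology. -/
def weakClosure (S : Set X) : Set X :=
  toWeakSpace ℝ X ⁻¹' closure (toWeakSpace ℝ X '' S)

/-- A set is relatively weakly compact if its weak closure is weakly compact. -/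
def RelWeaklyCompact (S : Set X) : Prop :=
  WeaklyCompact (weakClosure S)

/-- The De Blasi measure of weak noncompactness. -/
noncomputable def deBlasi (S : Set X) : ℝ :=
  sInf {r : ℝ | 0 ≤ r ∧ ∃ K : Set X, WeaklyCompact K ∧ S ⊆ K + Metric.closedBall (0 : X) r}
/-- Condition (P): the product of weakly convergent sequences converges weakly to the
product of the limits. -/
def CondP (X : Type*) [NormedRing X] [NormedAlgebra ℝ X] : Prop :=
  ∀ (u v : ℕ → X) (x y : X), WeakConv u x → WeakConv v y →
    WeakConv (fun n => u n * v n) (x * y)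

/-- Along an affine line of endomorphisms, the determinant at `1` is a fixed affine combination
of its values at any `finrank ℝ E + 1` distinct parameters. -/
theorem exists_det_one_add_eq_sum {E : Type*} [NormedAddCommGroup E] [NormedSpace ℝ E]
    [FiniteDimensional ℝ E] (v : ℕ → ℝ) (hv : Function.Injective v) :
    ∃ w : ℕ → ℝ, ∑ i ∈ Finset.range (Module.finrank ℝ E + 1), w i = 1 ∧
      ∀ A : E →L[ℝ] E, (1 + A).det =
        ∑ i ∈ Finset.range (Module.finrank ℝ E + 1), w i * (1 + v i • A).det := by
  classical
  set s := Finset.range (Module.finrank ℝ E + 1) with hs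
  have hinj : Set.InjOn v s := hv.injOn
  refine ⟨fun i => (Lagrange.basis s v i).eval 1, ?_, fun A => ?_⟩
  · rw [← Polynomial.eval_finsetSum, Lagrange.sum_basis hinj (by simp [hs]), Polynomial.eval_one]
  let b := Module.finBasis ℝ E
  let M := LinearMap.toMatrix b b (A : E →ₗ[ℝ] E)
  let p : Polynomial ℝ := Matrix.det
    ((Polynomial.X : Polynomial ℝ) • M.map Polynomial.C +
      (1 : Matrix _ _ ℝ).map Polynomial.C)
  have hp : ∀ t : ℝ, p.eval t = (1 + t • A).det := by
    intro t
    have h1 : (1 + t • A).det = LinearMap.det (((1 + t • A : E →L[ℝ] E)) : E →ₗ[ℝ] E) := rfl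
    rw [h1, ← LinearMap.det_toMatrix b]
    have h2 : LinearMap.toMatrix b b ((1 + t • A : E →L[ℝ] E) : E →ₗ[ℝ] E) = t • M + 1 := by
      have : ((1 + t • A : E →L[ℝ] E) : E →ₗ[ℝ] E) = t • (A : E →ₗ[ℝ] E) + 1 := by
        ext x; simp [add_comm]
      rw [this, map_add, map_smul, LinearMap.toMatrix_one]
    rw [h2]
    change Polynomial.evalRingHom t p = _
    rw [RingHom.map_det]
    congr 1
    ext i j
    simp [Matrix.one_apply]
    split_ifs <;> simp [mul_comm]
  have hdeg : p.degree < s.card := by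
    have := Polynomial.natDegree_det_X_add_C_le M 1
    rw [Fintype.card_fin] at this
    refine lt_of_le_of_lt Polynomial.degree_le_natDegree ?_
    rw [hs, Finset.card_range]
    exact_mod_cast Nat.lt_succ_of_le this
  have h := Lagrange.eq_interpolate hinj hdeg
  have h1 := congrArg (Polynomial.eval 1) h
  rw [hp, one_smul, Lagrange.interpolate_apply, Polynomial.eval_finsetSum] at h1
  rw [h1]
  refine Finset.sum_congr rfl fun i _ => ?_
  rw [Polynomial.eval_mul, Polynomial.eval_C, hp, mul_comm]

/-- A map that is Lipschitz on the closed unit ball and vanishes on the unit sphere stays Lipschitz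
when extended by zero. -/
theorem LipschitzOnWith.extend_zero_unitBall {E F : Type*} [NormedAddCommGroup E] [NormedSpace ℝ E]
    [NormedAddCommGroup F] {h : E → F} {L : NNReal}
    (hL : LipschitzOnWith L h (Metric.closedBall 0 1)) (h0 : ∀ x, ‖x‖ = 1 → h x = 0) :
    LipschitzWith (2 * L) (fun x => open Classical in if ‖x‖ ≤ 1 then h x else 0) := by
  classical
  have key : ∀ x y : E, ‖x‖ ≤ 1 → ¬ ‖y‖ ≤ 1 → ‖h x‖ ≤ 2 * L * ‖x - y‖ := by
    intro x y hx hy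
    push Not at hy
    have hy0 : ‖y‖ ≠ 0 := by positivity
    have hz : ‖(‖y‖⁻¹ • y)‖ = 1 := by rw [norm_smul, norm_inv, norm_norm, inv_mul_cancel₀ hy0]
    have h1 := hL.dist_le_mul x (by simpa using hx) (‖y‖⁻¹ • y) (by simp [hz])
    rw [h0 _ hz, dist_zero_right, dist_eq_norm] at h1
    have h2 : ‖y - ‖y‖⁻¹ • y‖ = ‖y‖ - 1 := by
      have : y - ‖y‖⁻¹ • y = (1 - ‖y‖⁻¹) • y := by rw [sub_smul, one_smul]
      rw [this, norm_smul, Real.norm_of_nonneg (by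
        rw [sub_nonneg]; exact inv_le_one_of_one_le₀ hy.le), sub_mul, inv_mul_cancel₀ hy0, one_mul]
    have h3 : ‖x - ‖y‖⁻¹ • y‖ ≤ ‖x - y‖ + ‖y - ‖y‖⁻¹ • y‖ := norm_sub_le_norm_sub_add_norm_sub _ _ _
    have h4 : ‖y‖ - ‖x‖ ≤ ‖x - y‖ := by rw [norm_sub_rev]; exact norm_sub_norm_le y x
    have h5 : ‖x - ‖y‖⁻¹ • y‖ ≤ 2 * ‖x - y‖ := by linarith
    calc ‖h x‖ ≤ L * ‖x - ‖y‖⁻¹ • y‖ := h1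
      _ ≤ L * (2 * ‖x - y‖) := by gcongr
      _ = _ := by ring
  refine LipschitzWith.of_dist_le_mul fun x y => ?_
  push_cast
  by_cases hx : ‖x‖ ≤ 1 <;> by_cases hy : ‖y‖ ≤ 1 <;> simp only [hx, hy, if_true, if_false]
  · refine (hL.dist_le_mul x (by simpa using hx) y (by simpa using hy)).trans ?_
    have : 0 ≤ (L : ℝ) * dist x y := by positivity
    linarith
  · rw [dist_zero_right, dist_eq_norm]; exact key x y hx hy
  · rw [dist_zero_left, dist_comm x y, dist_eq_norm]; exact key y x hy hx
  · rw [dist_self]; positivity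

/-- A `C¹` map of the closed unit ball into the sphere cannot fix the sphere pointwise. -/
theorem not_exists_contDiff_retraction {E : Type*} [NormedAddCommGroup E] [InnerProductSpace ℝ E]
    [FiniteDimensional ℝ E] (f : E → E) (hf : ∀ x, ‖x‖ ≤ 1 → ContDiffAt ℝ 1 f x)
    (hmap : ∀ x, ‖x‖ ≤ 1 → ‖f x‖ = 1) (hfix : ∀ x, ‖x‖ = 1 → f x = x) : False := by
  classical
  let _ : MeasurableSpace E := borel E
  have : BorelSpace E := ⟨rfl⟩
  set B : Set E := Metric.ball 0 1 with hB
  set μ : MeasureTheory.Measure E := MeasureTheory.volume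
  have hle : ∀ x ∈ B, ‖x‖ ≤ 1 := fun x hx => by
    have : ‖x‖ < 1 := by simpa [hB] using hx
    exact this.le
  set h : E → E := fun x => f x - x with hh
  have hcd : ∀ x, ‖x‖ ≤ 1 → ContDiffAt ℝ 1 h x := fun x hx => (hf x hx).sub contDiffAt_id
  obtain ⟨L, hL⟩ := ContDiffOn.exists_lipschitzOnWith (s := Metric.closedBall (0 : E) 1) (f := h)
    (fun x hx => (hcd x (by simpa using hx)).contDiffWithinAt) one_ne_zero
    (convex_closedBall _ _) (isCompact_closedBall _ _)
  have hext := hL.extend_zero_unitBall (fun x hx => by simp [hh, hfix x hx])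
  set k : E → E := fun x => if ‖x‖ ≤ 1 then h x else 0 with hk
  set A : E → E →L[ℝ] E := fun x => fderiv ℝ h x with hA
  have hAc : ContinuousOn A (Metric.closedBall 0 1) := fun x hx =>
    ((hcd x (by simpa using hx)).fderiv_right (m := 0) (by norm_num)).continuousAt.continuousWithinAt
  obtain ⟨M, hM⟩ := (isCompact_closedBall (0 : E) 1).exists_bound_of_continuousOn hAc
  have hM0 : 0 ≤ M := (norm_nonneg _).trans (hM 0 (by simp))
  -- positivity of the determinant near the identity
  obtain ⟨ε, hε, hdet⟩ : ∃ ε > 0, ∀ T : E →L[ℝ] E, ‖T‖ < ε → 0 < (1 + T).det := by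
    have hc : Continuous fun T : E →L[ℝ] E => (1 + T).det :=
      ContinuousLinearMap.continuous_det.comp (continuous_const.add continuous_id)
    have h1 : (0 : ℝ) < (1 + (0 : E →L[ℝ] E)).det := by
      rw [add_zero]
      have : (1 : E →L[ℝ] E).det = LinearMap.det (LinearMap.id : E →ₗ[ℝ] E) := rfl
      rw [this, LinearMap.det_id]; exact one_pos
    obtain ⟨ε, hε, hb⟩ := Metric.mem_nhds_iff.1 ((isOpen_lt continuous_const hc).mem_nhds h1)
    exact ⟨ε, hε, fun T hT => hb (by simpa using hT)⟩
  set δ : ℝ := min (ε / (M + 1)) (1 / (2 * L + 1)) with hδ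
  have hδ0 : 0 < δ := by positivity
  have hvol : ∀ t, 0 < t → t < δ → ∫ x in B, (1 + t • A x).det ∂μ = μ.real B := by
    intro t ht0 htδ
    have htε : t * M < ε := by
      have : t < ε / (M + 1) := htδ.trans_le (min_le_left _ _)
      rw [lt_div_iff₀ (by positivity)] at this
      linarith
    have htL : t * (2 * L) < 1 := by
      have : t < 1 / (2 * L + 1) := htδ.trans_le (min_le_right _ _)
      rw [lt_div_iff₀ (by positivity)] at this
      linarith
    have ht1 : t < 1 := by
      refine (htδ.trans_le (min_le_right _ _)).trans_le ?_
      rw [div_le_one (by positivity)]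
      linarith [L.2, (show (0 : ℝ) ≤ L from L.2)]
    set g : E → E := fun x => x + t • h x with hg
    have hder : ∀ x ∈ B, HasFDerivWithinAt g (1 + t • A x) B x := by
      intro x hx
      have h1 : HasFDerivAt h (A x) x := ((hcd x (hle x hx)).differentiableAt one_ne_zero).hasFDerivAt
      exact ((hasFDerivAt_id x).add (h1.const_smul t)).hasFDerivWithinAt
    have hkk : ∀ x ∈ B, k x = h x := fun x hx => by simp [hk, hle x hx]
    have hinj : Set.InjOn g B := by
      intro x hx y hy hxy
      have h1 : x - y = t • (k y - k x) := by
        rw [hkk x hx, hkk y hy, smul_sub, sub_eq_sub_iff_add_eq_add]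
        simpa [hg, add_comm] using hxy
      have h2 : ‖x - y‖ ≤ t * (2 * L) * ‖x - y‖ := by
        have h3 := hext.dist_le_mul y x
        rw [dist_eq_norm, dist_eq_norm, norm_sub_rev y x] at h3
        push_cast at h3
        calc ‖x - y‖ = t * ‖k y - k x‖ := by rw [h1, norm_smul, Real.norm_of_nonneg ht0.le]
          _ ≤ t * (2 * L * ‖x - y‖) := by gcongr
          _ = _ := by ring
      by_contra hne
      have : 0 < ‖x - y‖ := norm_pos_iff.2 (sub_ne_zero.2 hne)
      nlinarith
    have himg : g '' B = B := by
      apply Set.Subset.antisymm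
      · rintro _ ⟨x, hx, rfl⟩
        have hx1 : ‖x‖ < 1 := by simpa [hB] using hx
        have h1 : g x = (1 - t) • x + t • f x := by simp only [hg, hh, smul_sub, sub_smul, one_smul]; abel
        have h2 : ‖g x‖ ≤ (1 - t) * ‖x‖ + t * 1 := by
          rw [h1]
          refine (norm_add_le _ _).trans ?_
          rw [norm_smul, norm_smul, Real.norm_of_nonneg ht0.le, Real.norm_of_nonneg (by linarith),
            hmap x hx1.le]
        have : ‖g x‖ < 1 := by nlinarith
        simpa [hB] using this
      · intro y hy
        have hc : ContractingWith (Real.toNNReal t * (2 * L)) (fun x => y - t • k x) := by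
          constructor
          · rw [← NNReal.coe_lt_coe]; push_cast; rwa [Real.coe_toNNReal t ht0.le]
          · refine LipschitzWith.of_dist_le_mul fun x z => ?_
            have h3 := hext.dist_le_mul x z
            rw [dist_sub_left, dist_smul₀, Real.norm_of_nonneg ht0.le]
            push_cast at h3 ⊢
            rw [Real.coe_toNNReal t ht0.le]
            calc t * dist (k x) (k z) ≤ t * (2 * L * dist x z) := by gcongr
              _ = _ := by ring
        have hfp := hc.fixedPoint_isFixedPt
        set x := ContractingWith.fixedPoint _ hc
        have hx : x = y - t • k x := hfp.symm
        have hxB : x ∈ B := by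
          by_contra hxB
          have hx1 : 1 ≤ ‖x‖ := by simpa [hB] using hxB
          have hk0 : k x = 0 := by
            simp only [hk]
            split_ifs with h1
            · simp [hh, hfix x (le_antisymm h1 hx1)]
            · rfl
          rw [hk0, smul_zero, sub_zero] at hx
          exact hxB (hx ▸ hy)
        refine ⟨x, hxB, ?_⟩
        simp only [hg]
        rw [← hkk x hxB]
        nth_rewrite 1 [hx]
        abel
    have := MeasureTheory.integral_image_eq_integral_abs_det_fderiv_smul μ
      (Metric.isOpen_ball.measurableSet) hder hinj (fun _ => (1 : ℝ))
    rw [himg] at this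
    simp only [smul_eq_mul, mul_one] at this
    rw [MeasureTheory.setIntegral_const, smul_eq_mul, mul_one] at this
    rw [this]
    refine MeasureTheory.setIntegral_congr_fun Metric.isOpen_ball.measurableSet fun x hx => ?_
    refine (abs_of_pos (hdet _ ?_)).symm
    rw [norm_smul, Real.norm_of_nonneg ht0.le]
    refine lt_of_le_of_lt ?_ htε
    gcongr
    exact hM x (Metric.ball_subset_closedBall hx)
  -- interpolation from small parameters to `1`
  set v : ℕ → ℝ := fun i => δ / (i + 2) with hv
  have hvinj : Function.Injective v := by
    intro i j hij
    simp only [hv] at hij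
    rw [div_eq_div_iff (by positivity) (by positivity)] at hij
    exact_mod_cast (add_right_cancel (mul_left_cancel₀ hδ0.ne' hij)).symm
  obtain ⟨w, hw1, hw⟩ := exists_det_one_add_eq_sum (E := E) v hvinj
  have hint : ∀ t : ℝ, MeasureTheory.IntegrableOn (fun x => (1 + t • A x).det) B μ := by
    intro t
    refine (ContinuousOn.integrableOn_compact (isCompact_closedBall 0 1) ?_).mono_set
      Metric.ball_subset_closedBall
    exact ContinuousLinearMap.continuous_det.comp_continuousOn
      (continuousOn_const.add (hAc.const_smul t))
  have hone : ∫ x in B, (1 + A x).det ∂μ = μ.real B := by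
    rw [funext fun x => hw (A x)]
    rw [MeasureTheory.integral_finsetSum _ fun i _ => (hint (v i)).const_mul (w i)]
    simp_rw [MeasureTheory.integral_const_mul]
    have : ∀ i ∈ Finset.range (Module.finrank ℝ E + 1),
        w i * ∫ x in B, (1 + v i • A x).det ∂μ = w i * μ.real B := by
      intro i _
      rw [hvol (v i) (by positivity)]
      exact div_lt_self hδ0 (by linarith [(Nat.cast_nonneg i : (0 : ℝ) ≤ i)])
    rw [Finset.sum_congr rfl this, ← Finset.sum_mul, hw1, one_mul]
  have hzero : ∫ x in B, (1 + A x).det ∂μ = 0 := by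
    refine MeasureTheory.setIntegral_eq_zero_of_forall_eq_zero fun x hx => ?_
    have hd : HasFDerivAt f (fderiv ℝ f x) x :=
      ((hf x (hle x hx)).differentiableAt one_ne_zero).hasFDerivAt
    have hAx : 1 + A x = fderiv ℝ f x := by
      have : HasFDerivAt h (fderiv ℝ f x - 1) x := hd.sub (hasFDerivAt_id x)
      simp only [hA]; rw [this.fderiv]; abel
    rw [hAx]
    by_contra hne
    have h1 := HasFDerivAt.inner ℝ hd hd
    have h2 : (fun y => inner ℝ (f y) (f y)) =ᶠ[𝓝 x] fun _ => (1 : ℝ) := by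
      filter_upwards [Metric.isOpen_ball.mem_nhds hx] with y hy
      rw [real_inner_self_eq_norm_sq, hmap y (hle y hy)]; norm_num
    have h3 := h1.unique ((hasFDerivAt_const (1 : ℝ) x).congr_of_eventuallyEq h2)
    have hne' : LinearMap.det (fderiv ℝ f x : E →ₗ[ℝ] E) ≠ 0 := hne
    let e := LinearMap.equivOfDetNeZero (fderiv ℝ f x : E →ₗ[ℝ] E) hne'
    obtain ⟨u, hu⟩ := e.surjective (f x)
    have hu' : fderiv ℝ f x u = f x := hu
    have h4 := congrArg (fun T : E →L[ℝ] ℝ => T u) h3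
    simp [fderivInnerCLM_apply, hu'] at h4
    have := hmap x (hle x hx)
    rw [h4] at this
    simp at this
  have hpos : 0 < μ.real B := by
    rw [MeasureTheory.measureReal_def]
    exact ENNReal.toReal_pos (Metric.measure_ball_pos μ 0 one_pos).ne' MeasureTheory.measure_ball_lt_top.ne
  linarith

/-- A smooth fixed-point-free map of the closed unit ball into itself yields a smooth retraction
onto the sphere, hence cannot exist. -/
theorem exists_fixedPoint_of_contDiff_unitBall {E : Type*} [NormedAddCommGroup E]
    [InnerProductSpace ℝ E] [FiniteDimensional ℝ E] (p : E → E) (hp : ContDiff ℝ 1 p)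
    (hp1 : ∀ x, ‖x‖ ≤ 1 → ‖p x‖ ≤ 1) : ∃ x, ‖x‖ ≤ 1 ∧ p x = x := by
  by_contra! hne
  set u : E → E := fun x => x - p x with hu
  set a : E → ℝ := fun x => inner ℝ (u x) (u x) with ha
  set b : E → ℝ := fun x => inner ℝ x (u x) with hb
  set c : E → ℝ := fun x => inner ℝ x x - 1 with hc
  have ha0 : ∀ x, ‖x‖ ≤ 1 → 0 < a x := fun x hx => by
    simp only [ha, real_inner_self_eq_norm_sq]
    have : u x ≠ 0 := sub_ne_zero.2 (hne x hx).symm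
    positivity
  have hD : ∀ x, ‖x‖ ≤ 1 → 0 < b x ^ 2 - a x * c x := by
    intro x hx
    have h0 := ha0 x hx
    have h1 : a x = ‖x‖ ^ 2 - 2 * inner ℝ x (p x) + ‖p x‖ ^ 2 := by
      simp only [ha, hu, real_inner_self_eq_norm_sq, norm_sub_sq_real]
    have h2 : b x = ‖x‖ ^ 2 - inner ℝ x (p x) := by
      simp only [hb, hu, inner_sub_right, real_inner_self_eq_norm_sq]
    have h3 : c x = ‖x‖ ^ 2 - 1 := by simp only [hc, real_inner_self_eq_norm_sq]
    have h4 := hp1 x hx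
    rcases hx.lt_or_eq with hlt | heq
    · have : c x < 0 := by rw [h3]; nlinarith [norm_nonneg x]
      nlinarith [sq_nonneg (b x)]
    · have hc0 : c x = 0 := by rw [h3, heq]; norm_num
      have : 0 < b x := by
        rw [heq] at h1 h2
        nlinarith [norm_nonneg (p x)]
      rw [hc0]; nlinarith
  have hud : ContDiff ℝ 1 u := contDiff_id.sub hp
  have had : ContDiff ℝ 1 a := hud.inner ℝ hud
  have hbd : ContDiff ℝ 1 b := contDiff_id.inner ℝ hud
  have hcd : ContDiff ℝ 1 c := (contDiff_id.inner ℝ contDiff_id).sub contDiff_const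
  set l : E → ℝ := fun x => (-b x + √(b x ^ 2 - a x * c x)) / a x with hl
  have hroot : ∀ x, ‖x‖ ≤ 1 → a x * l x ^ 2 + 2 * b x * l x + c x = 0 := by
    intro x hx
    have h0 := (ha0 x hx).ne'
    have h1 := Real.sq_sqrt (hD x hx).le
    simp only [hl]
    field_simp
    linear_combination h1
  refine not_exists_contDiff_retraction (fun x => x + l x • u x) (fun x hx => ?_) (fun x hx => ?_)
    fun x hx => ?_
  · refine contDiffAt_id.add (ContDiffAt.smul ?_ hud.contDiffAt)
    refine ContDiffAt.div ?_ had.contDiffAt (ha0 x hx).ne'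
    exact hbd.contDiffAt.neg.add
      (((hbd.pow 2).sub (had.mul hcd)).contDiffAt.sqrt (hD x hx).ne')
  · have h1 := hroot x hx
    have h2 : ‖x + l x • u x‖ ^ 2 = 1 := by
      rw [norm_add_sq_real, inner_smul_right, norm_smul, mul_pow, Real.norm_eq_abs, sq_abs,
        ← real_inner_self_eq_norm_sq, ← real_inner_self_eq_norm_sq]
      simp only [ha, hb, hc] at h1
      linarith
    exact (pow_eq_one_iff_of_nonneg (norm_nonneg _) two_ne_zero).1 h2
  · have hc0 : c x = 0 := by simp [hc, hx]
    have hb0 : 0 ≤ b x := by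
      have h1 : b x = 1 - inner ℝ x (p x) := by
        simp only [hb, hu, inner_sub_right, real_inner_self_eq_norm_sq, hx]; norm_num
      have h2 := real_inner_le_norm x (p x)
      have h3 := hp1 x hx.le
      rw [hx] at h2
      linarith
    have : l x = 0 := by
      simp only [hl, hc0, mul_zero, sub_zero, Real.sqrt_sq hb0, neg_add_cancel, zero_div]
    simp [this]

/-- **Brouwer's fixed point theorem** for continuous maps with values in the unit ball. -/
theorem exists_fixedPoint_of_continuous_unitBall {E : Type*} [NormedAddCommGroup E]
    [InnerProductSpace ℝ E] [FiniteDimensional ℝ E] (g : E → E) (hg : Continuous g)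
    (hg1 : ∀ x, ‖g x‖ ≤ 1) : ∃ x, g x = x := by
  by_contra! hne
  obtain ⟨x₀, -, hx₀⟩ := (isCompact_closedBall (0 : E) 1).exists_isMinOn ⟨0, by simp⟩
    (hg.sub continuous_id).norm.continuousOn
  set η := ‖g x₀ - x₀‖ with hη
  have hη0 : 0 < η := norm_pos_iff.2 (sub_ne_zero.2 (hne x₀))
  obtain ⟨q, hq, hqg⟩ : ∃ q : E → E, ContDiff ℝ 1 q ∧ ∀ x, dist (q x) (g x) < η / 2 := by
    obtain ⟨q, hq, h, -⟩ := hg.exists_contDiff_approx 1 (ε := fun _ => η / 2) continuous_const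
      fun _ => by positivity
    exact ⟨q, hq, h⟩
  have hqn : ∀ x, ‖q x‖ ≤ 1 + η / 2 := fun x => by
    have h1 := hqg x
    rw [dist_eq_norm] at h1
    have := norm_le_norm_add_norm_sub' (q x) (g x)
    linarith [hg1 x]
  set p : E → E := fun x => (1 + η / 2)⁻¹ • q x with hp
  have h1η : 0 < 1 + η / 2 := by positivity
  have hpn : ∀ x, ‖p x‖ ≤ 1 := fun x => by
    rw [hp]
    simp only [norm_smul, norm_inv, Real.norm_of_nonneg h1η.le]
    rw [inv_mul_le_iff₀ h1η, mul_one]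
    exact hqn x
  obtain ⟨x, hx, hpx⟩ := exists_fixedPoint_of_contDiff_unitBall p (hq.const_smul _)
    fun x _ => hpn x
  have h1 : η ≤ ‖g x - x‖ := hx₀ (show x ∈ Metric.closedBall (0 : E) 1 by simpa using hx)
  have h2 : q x = (1 + η / 2) • x := by
    nth_rewrite 2 [← hpx]
    exact (smul_inv_smul₀ h1η.ne' _).symm
  have h3 := hqg x
  rw [dist_comm, dist_eq_norm, h2] at h3
  have h4 : g x - x = (g x - (1 + η / 2) • x) + (η / 2) • x := by
    rw [add_smul, one_smul]; abel
  have h5 : ‖(η / 2) • x‖ ≤ η / 2 := by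
    rw [norm_smul, Real.norm_of_nonneg (by positivity)]
    nlinarith
  rw [h4] at h1
  linarith [norm_add_le (g x - (1 + η / 2) • x) ((η / 2) • x)]

/-- The standard simplex is a retract of the ambient space. -/
theorem exists_retraction_stdSimplex (ι : Type*) [Fintype ι] [Nonempty ι] :
    ∃ r : (ι → ℝ) → ι → ℝ, Continuous r ∧ (∀ x, r x ∈ stdSimplex ℝ ι) ∧
      ∀ x ∈ stdSimplex ℝ ι, r x = x := by
  set s : (ι → ℝ) → ℝ := fun x => ∑ i, max (x i) 0 with hs
  have hsc : Continuous s := by fun_prop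
  have hpos : ∀ x, 0 < max (s x) 1 := fun x => lt_max_of_lt_right one_pos
  refine ⟨fun x i => (max (x i) 0 + max (1 - s x) 0 / Fintype.card ι) / max (s x) 1, ?_,
    fun x => ⟨fun i => ?_, ?_⟩, fun x hx => ?_⟩
  · refine continuous_pi fun i => ?_
    refine Continuous.div ?_ (by fun_prop) fun x => (hpos x).ne'
    fun_prop
  · have := hpos x
    positivity
  · rw [← Finset.sum_div, div_eq_one_iff_eq (hpos x).ne', Finset.sum_add_distrib, Finset.sum_const,
      Finset.card_univ, nsmul_eq_mul, mul_div_cancel₀ _ (by simp)]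
    rcases le_total (s x) 1 with h | h
    · rw [max_eq_right h, max_eq_left (by linarith)]; simp [hs]
    · rw [max_eq_left h, max_eq_right (by linarith)]; simp [hs]
  · have h1 : ∀ i, max (x i) 0 = x i := fun i => max_eq_left (hx.1 i)
    have h2 : s x = 1 := by simp only [hs, h1, hx.2]
    funext i
    simp [h1, h2]

/-- **Brouwer's fixed point theorem** on the standard simplex. -/
theorem exists_fixedPoint_stdSimplex {ι : Type*} [Fintype ι] [Nonempty ι]
    (g : (ι → ℝ) → ι → ℝ) (hg : ContinuousOn g (stdSimplex ℝ ι))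
    (hmaps : Set.MapsTo g (stdSimplex ℝ ι) (stdSimplex ℝ ι)) :
    ∃ x ∈ stdSimplex ℝ ι, g x = x := by
  obtain ⟨r, hr, hrm, hrf⟩ := exists_retraction_stdSimplex ι
  have hgr : Continuous (g ∘ r) := hg.comp_continuous hr hrm
  obtain ⟨x, hx⟩ := exists_fixedPoint_of_continuous_unitBall
    (fun y : EuclideanSpace ℝ ι => WithLp.toLp 2 ((g ∘ r) (WithLp.ofLp y)))
    ((PiLp.continuous_toLp 2 _).comp (hgr.comp (PiLp.continuous_ofLp 2 _))) (fun y => by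
      have h := hmaps (hrm (WithLp.ofLp y))
      rw [EuclideanSpace.norm_eq, Real.sqrt_le_one]
      calc ∑ i, ‖g (r (WithLp.ofLp y)) i‖ ^ 2 ≤ ∑ i, g (r (WithLp.ofLp y)) i := by
            refine Finset.sum_le_sum fun i _ => ?_
            rw [Real.norm_of_nonneg (h.1 i)]
            have : g (r (WithLp.ofLp y)) i ≤ 1 := by
              rw [← h.2]; exact Finset.single_le_sum (fun j _ => h.1 j) (Finset.mem_univ i)
            nlinarith [h.1 i]
        _ = 1 := h.2)
  have hx' : g (r (WithLp.ofLp x)) = WithLp.ofLp x := congrArg WithLp.ofLp hx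
  have hmem : WithLp.ofLp x ∈ stdSimplex ℝ ι := hx' ▸ hmaps (hrm _)
  exact ⟨_, hmem, by rwa [hrf _ hmem] at hx'⟩

theorem WeakConv.comp_strictMono {E : Type*} [NormedAddCommGroup E] [NormedSpace ℝ E]
    {u : ℕ → E} {x : E} (h : WeakConv u x) {φ : ℕ → ℕ} (hφ : StrictMono φ) :
    WeakConv (fun n => u (φ n)) x :=
  fun f => (h f).comp hφ.tendsto_atTop

theorem WeakConv.unique {E : Type*} [NormedAddCommGroup E] [NormedSpace ℝ E]
    {u : ℕ → E} {x y : E} (hx : WeakConv u x) (hy : WeakConv u y) : x = y := by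
  by_contra hne
  obtain ⟨f, -, hf⟩ := exists_dual_vector'' ℝ (x - y)
  have h := tendsto_nhds_unique (hx f) (hy f)
  rw [map_sub, h, sub_self] at hf
  exact hne (sub_eq_zero.1 (norm_eq_zero.1 (by simpa using hf.symm)))

theorem WeakConv.of_tendsto {E : Type*} [NormedAddCommGroup E] [NormedSpace ℝ E]
    {u : ℕ → E} {x : E} (h : Tendsto u atTop (𝓝 x)) : WeakConv u x :=
  fun f => (f.continuous.tendsto x).comp h

theorem WeakConv.mem_of_isClosed_of_convex {E : Type*} [NormedAddCommGroup E] [NormedSpace ℝ E]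
    {K : Set E} (hK : IsClosed K) (hc : Convex ℝ K) {u : ℕ → E} {x : E} (hu : ∀ n, u n ∈ K)
    (h : WeakConv u x) : x ∈ K := by
  by_contra hx
  obtain ⟨f, c, hfx, hfK⟩ := geometric_hahn_banach_point_closed hc hK hx
  exact absurd (ge_of_tendsto' (h f) fun n => (hfK _ (hu n)).le) (not_le.2 hfx)

/-- Countably many functionals separate the points of a separable set. -/
theorem exists_seq_clm_separating {E : Type*} [NormedAddCommGroup E] [NormedSpace ℝ E]
    {D : Set E} (hD : D.Countable) :
    ∃ F : ℕ → E →L[ℝ] ℝ, ∀ x ∈ closure D, ∀ y ∈ closure D, (∀ i, F i x = F i y) → x = y := by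
  have := hD.to_subtype
  choose g hg1 hg using fun p : D × D => exists_dual_vector'' ℝ ((p.1 : E) - p.2)
  rcases isEmpty_or_nonempty (D × D) with hemp | hne
  · refine ⟨fun _ => 0, fun x hx => ?_⟩
    obtain ⟨d, hd, -⟩ := Metric.mem_closure_iff.1 hx 1 one_pos
    exact (hemp.false (⟨d, hd⟩, ⟨d, hd⟩)).elim
  obtain ⟨e, he⟩ := exists_surjective_nat (D × D)
  refine ⟨fun i => g (e i), fun x hx y hy hxy => ?_⟩
  refine eq_of_forall_dist_le fun ε hε => ?_
  obtain ⟨d, hd, hxd⟩ := Metric.mem_closure_iff.1 hx (ε / 4) (by positivity)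
  obtain ⟨d', hd', hyd⟩ := Metric.mem_closure_iff.1 hy (ε / 4) (by positivity)
  obtain ⟨i, hi⟩ := he (⟨d, hd⟩, ⟨d', hd'⟩)
  have h1 : g (e i) (d - d') = ‖d - d'‖ := by rw [hi]; exact hg (⟨d, hd⟩, ⟨d', hd'⟩)
  have h2 : g (e i) (d - d') = g (e i) (d - x) + g (e i) (y - d') := by
    have h := hxy i
    simp only [map_sub]
    linarith
  have hle : ∀ z, g (e i) z ≤ ‖z‖ := fun z => by
    refine (le_abs_self _).trans (((g (e i)).le_opNorm z).trans ?_)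
    nlinarith [hg1 (e i), norm_nonneg z]
  have h3 := hle (d - x)
  have h4 := hle (y - d')
  rw [dist_eq_norm] at hxd hyd ⊢
  have h5 : ‖x - y‖ ≤ ‖x - d‖ + ‖d - d'‖ + ‖y - d'‖ := by
    calc ‖x - y‖ = ‖(x - d) + (d - d') - (y - d')‖ := by congr 1; abel
      _ ≤ ‖(x - d) + (d - d')‖ + ‖y - d'‖ := norm_sub_le _ _
      _ ≤ _ := by gcongr; exact norm_add_le _ _
  rw [norm_sub_rev d x] at h3
  linarith

/-- The easy half of the **Eberlein–Šmulian theorem**. -/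
theorem RelWeaklyCompact.exists_subseq {E : Type*} [NormedAddCommGroup E] [NormedSpace ℝ E]
    {W : Set E} (hW : RelWeaklyCompact W) {u : ℕ → E} (hu : ∀ n, u n ∈ W) :
    ∃ φ : ℕ → ℕ, StrictMono φ ∧ ∃ x : E, WeakConv (fun n => u (φ n)) x := by
  set Y : Submodule ℝ E := (Submodule.span ℝ (Set.range u)).topologicalClosure with hY
  have hYs : TopologicalSpace.IsSeparable (Y : Set E) := by
    rw [hY, Submodule.topologicalClosure_coe]
    exact ((Set.countable_range u).isSeparable.span (R := ℝ)).closure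
  have hYc : IsClosed (Y : Set E) := Submodule.isClosed_topologicalClosure _
  have hYconv : Convex ℝ (Y : Set E) := Y.convex
  have huY : ∀ n, u n ∈ Y := fun n =>
    Submodule.le_topologicalClosure _ (Submodule.subset_span ⟨n, rfl⟩)
  obtain ⟨D, hD, hYD⟩ := hYs
  obtain ⟨F, hF⟩ := exists_seq_clm_separating hD
  set w : E → WeakSpace ℝ E := fun x => toWeakSpace ℝ E x with hw
  have hcont : ∀ f : E →L[ℝ] ℝ, Continuous fun z : WeakSpace ℝ E => f ((toWeakSpace ℝ E).symm z) :=
    fun f => WeakBilin.eval_continuous _ f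
  set Z : Set (WeakSpace ℝ E) := closure (w '' W) with hZ
  have hZc : IsCompact Z := by
    have : w '' weakClosure W = Z := Set.image_preimage_eq _ (toWeakSpace ℝ E).surjective
    rw [← this]; exact hW
  have huZ : ∀ n, w (u n) ∈ Z := fun n => subset_closure ⟨_, hu n, rfl⟩
  set Φ : WeakSpace ℝ E → ℕ → ℝ := fun z i => F i ((toWeakSpace ℝ E).symm z) with hΦ
  have hΦc : Continuous Φ := continuous_pi fun i => hcont (F i)
  obtain ⟨y, -, φ, hφ, hlim⟩ := (hZc.image hΦc).tendsto_subseq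
    (x := fun n => Φ (w (u n))) fun n => ⟨_, huZ n, rfl⟩
  have hmem : ∀ z, MapClusterPt z atTop (fun n => w (u (φ n))) →
      (toWeakSpace ℝ E).symm z ∈ closure D ∧ Φ z = y := by
    intro z hz
    constructor
    · refine hYD ?_
      have h1 : z ∈ closure (w '' Y) :=
        isClosed_closure.mem_of_mapClusterPt hz
          (Eventually.of_forall fun n => subset_closure ⟨_, huY _, rfl⟩)
      have h2 := hYconv.toWeakSpace_closure ℝ
      rw [hYc.closure_eq] at h2
      change z ∈ closure (toWeakSpace ℝ E '' (Y : Set E)) at h1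
      rw [← h2] at h1
      obtain ⟨a, ha, rfl⟩ := h1
      simpa using ha
    · have h1 : MapClusterPt (Φ z) atTop (fun n => Φ (w (u (φ n)))) :=
        MapClusterPt.continuousAt_comp hΦc.continuousAt hz
      have h2 : (𝓝 (Φ z) ⊓ 𝓝 y).NeBot := ClusterPt.mono h1 hlim
      exact eq_of_nhds_neBot h2
  obtain ⟨z, hzZ, hz⟩ := hZc.exists_mapClusterPt (f := atTop) (u := fun n => w (u (φ n)))
    (tendsto_principal.2 (Eventually.of_forall fun n => huZ (φ n)))
  have ht : Tendsto (fun n => w (u (φ n))) atTop (𝓝 z) := by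
    refine hZc.tendsto_nhds_of_unique_mapClusterPt (Eventually.of_forall fun n => huZ _) ?_
    intro z' _ hz'
    obtain ⟨h1, h2⟩ := hmem z hz
    obtain ⟨h1', h2'⟩ := hmem z' hz'
    refine (toWeakSpace ℝ E).symm.injective (hF _ h1' _ h1 fun i => ?_)
    exact congrFun (h2'.trans h2.symm) i
  exact ⟨φ, hφ, (toWeakSpace ℝ E).symm z, fun f => ((hcont f).tendsto z).comp ht⟩

/-- A weakly sequentially continuous self-map of a closed convex set leaves invariant a nonempty
separable closed convex subset. -/
theorem exists_separable_invariant {E : Type*} [NormedAddCommGroup E] [NormedSpace ℝ E]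
    {S : Set E} (hne : S.Nonempty) (hcl : IsClosed S) (hconv : Convex ℝ S) {N : E → E}
    (hmaps : Set.MapsTo N S S)
    (hN : ∀ (u : ℕ → E) (x : E), (∀ n, u n ∈ S) → x ∈ S → WeakConv u x →
      WeakConv (fun n => N (u n)) (N x)) :
    ∃ D : Set E, D.Countable ∧ D.Nonempty ∧ closure D ⊆ S ∧ Convex ℝ (closure D) ∧
      Set.MapsTo N (closure D) (closure D) := by
  obtain ⟨x₀, hx₀⟩ := hne
  set c : ℝ → ℝ := fun r => max 0 (min 1 r) with hc
  have hcc : Continuous c := by fun_prop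
  have hc0 : ∀ r, 0 ≤ c r := fun r => le_max_left _ _
  have hc1 : ∀ r, c r ≤ 1 := fun r => max_le zero_le_one (min_le_left _ _)
  set m : ℝ → E → E → E := fun r x y => c r • x + (1 - c r) • y with hm
  set step : Set E → Set E := fun D => D ∪ (N '' D ∪ ⋃ q : ℚ, Set.image2 (m q) D D) with hstep
  set G : ℕ → Set E := fun n => step^[n] {x₀} with hG
  have hGs : ∀ n, G (n + 1) = step (G n) := fun n => Function.iterate_succ_apply' _ _ _
  have hcount : ∀ n, (G n).Countable := by
    intro n
    induction n with
    | zero => exact Set.countable_singleton x₀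
    | succ n ih =>
      rw [hGs]
      exact ih.union ((ih.image N).union (Set.countable_iUnion fun q => ih.image2 ih _))
  have hsub : ∀ n, G n ⊆ S := by
    intro n
    induction n with
    | zero => exact Set.singleton_subset_iff.2 hx₀
    | succ n ih =>
      rw [hGs]
      refine Set.union_subset ih (Set.union_subset ?_ (Set.iUnion_subset fun q => ?_))
      · rintro _ ⟨x, hx, rfl⟩
        exact hmaps (ih hx)
      · rintro _ ⟨x, hx, y, hy, rfl⟩
        exact hconv (ih hx) (ih hy) (hc0 _) (sub_nonneg.2 (hc1 _)) (by ring)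
  have hmono : Monotone G := monotone_nat_of_le_succ fun n => by
    rw [hGs]; exact Set.subset_union_left
  set D : Set E := ⋃ n, G n with hD
  have hDS : closure D ⊆ S := closure_minimal (Set.iUnion_subset hsub) hcl
  have hDN : ∀ x ∈ D, N x ∈ D := by
    intro x hx
    obtain ⟨n, hn⟩ := Set.mem_iUnion.1 hx
    refine Set.mem_iUnion.2 ⟨n + 1, ?_⟩
    rw [hGs]
    exact Or.inr (Or.inl ⟨x, hn, rfl⟩)
  have hDm : ∀ (q : ℚ), ∀ x ∈ D, ∀ y ∈ D, m q x y ∈ D := by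
    intro q x hx y hy
    obtain ⟨n, hn⟩ := Set.mem_iUnion.1 hx
    obtain ⟨k, hk⟩ := Set.mem_iUnion.1 hy
    refine Set.mem_iUnion.2 ⟨max n k + 1, ?_⟩
    rw [hGs]
    exact Or.inr (Or.inr (Set.mem_iUnion.2 ⟨q, x, hmono (le_max_left _ _) hn, y,
      hmono (le_max_right _ _) hk, rfl⟩))
  have hDconv : Convex ℝ (closure D) := by
    intro x hx y hy a b ha hb hab
    have hall : ∀ r : ℝ, m r x y ∈ closure D := by
      intro r
      refine Rat.denseRange_cast.induction_on (p := fun r : ℝ => m r x y ∈ closure D) r ?_ ?_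
      · refine isClosed_closure.preimage (f := fun r : ℝ => m r x y) ?_
        simp only [hm]; fun_prop
      · intro q
        refine map_mem_closure₂ (f := m q) ?_ hx hy (hDm q)
        simp only [hm, Function.uncurry_def]; fun_prop
    have h1 : c a = a := by
      simp only [hc]; rw [min_eq_right (by linarith), max_eq_right ha]
    have h2 := hall a
    simp only [hm, h1] at h2
    rwa [show b = 1 - a by linarith]
  refine ⟨D, Set.countable_iUnion hcount, ⟨x₀, Set.mem_iUnion.2 ⟨0, rfl⟩⟩, hDS, hDconv, ?_⟩
  intro x hx
  obtain ⟨u, hu, hux⟩ := mem_closure_iff_seq_limit.1 hx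
  exact (hN u x (fun n => hDS (subset_closure (hu n))) (hDS hx)
    (WeakConv.of_tendsto hux)).mem_of_isClosed_of_convex isClosed_closure hDconv
    fun n => subset_closure (hDN _ (hu n))

/-- An approximate form of **Schauder's fixed point theorem**, with the error measured through a
continuous linear map with totally bounded range. -/
theorem exists_approx_fixedPoint {E F : Type*} [NormedAddCommGroup E] [NormedSpace ℝ E]
    [NormedAddCommGroup F] [NormedSpace ℝ F] {T : Set E} (hne : T.Nonempty) (L : E →L[ℝ] F)
    (hL : TotallyBounded (L '' T)) {N : E → E} (hmaps : Set.MapsTo N (convexHull ℝ T) T)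
    (hN : ContinuousOn (fun x => L (N x)) (convexHull ℝ T)) {ε : ℝ} (hε : 0 < ε) :
    ∃ x ∈ convexHull ℝ T, ‖L x - L (N x)‖ ≤ ε := by
  obtain ⟨s, hsT, hsf, hsc⟩ := Metric.finite_approx_of_totallyBounded hL ε hε
  have := hsf.fintype
  choose t htT hts using fun j : s => hsT j.2
  obtain ⟨x₀, hx₀⟩ := hne
  have hcover : ∀ y ∈ T, ∃ j : s, ‖L y - L (t j)‖ < ε := by
    intro y hy
    obtain ⟨z, hz, hyz⟩ := Set.mem_iUnion₂.1 (hsc ⟨y, hy, rfl⟩)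
    refine ⟨⟨z, hz⟩, ?_⟩
    rw [hts ⟨z, hz⟩, ← dist_eq_norm]
    exact hyz
  have : Nonempty s := ⟨(hcover x₀ hx₀).choose⟩
  set w : F → s → ℝ := fun y j => max 0 (ε - ‖y - L (t j)‖) with hw
  have hw0 : ∀ y j, 0 ≤ w y j := fun y j => le_max_left _ _
  have hwpos : ∀ y ∈ T, 0 < ∑ j, w (L y) j := by
    intro y hy
    obtain ⟨j, hj⟩ := hcover y hy
    exact Finset.sum_pos' (fun j _ => hw0 _ j)
      ⟨j, Finset.mem_univ _, lt_max_of_lt_right (sub_pos.2 hj)⟩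
  set p : (s → ℝ) → E := fun l => ∑ j, l j • t j with hp
  have hpmem : Set.MapsTo p (stdSimplex ℝ s) (convexHull ℝ T) := fun l hl =>
    (convex_convexHull ℝ T).sum_mem (fun j _ => hl.1 j) hl.2
      fun j _ => subset_convexHull ℝ T (htT j)
  set g : (s → ℝ) → s → ℝ := fun l j => w (L (N (p l))) j / ∑ k, w (L (N (p l))) k with hg
  have hpT : ∀ l ∈ stdSimplex ℝ s, N (p l) ∈ T := fun l hl => hmaps (hpmem hl)
  have hpc : ContinuousOn (fun l => L (N (p l))) (stdSimplex ℝ s) := by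
    refine hN.comp (Continuous.continuousOn ?_) hpmem
    simp only [hp]; fun_prop
  have hwc : ∀ j, ContinuousOn (fun l => w (L (N (p l))) j) (stdSimplex ℝ s) := by
    intro j
    have : Continuous fun y => w y j := by simp only [hw]; fun_prop
    exact this.comp_continuousOn hpc
  have hgc : ContinuousOn g (stdSimplex ℝ s) := by
    refine continuousOn_pi.2 fun j => (hwc j).div ?_ fun l hl => (hwpos _ (hpT l hl)).ne'
    exact continuousOn_finsetSum _ fun k _ => hwc k
  have hgm : Set.MapsTo g (stdSimplex ℝ s) (stdSimplex ℝ s) := by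
    intro l hl
    have hpos := hwpos _ (hpT l hl)
    refine ⟨fun j => div_nonneg (hw0 _ j) hpos.le, ?_⟩
    rw [← Finset.sum_div, div_self hpos.ne']
  obtain ⟨l, hl, hgl⟩ := exists_fixedPoint_stdSimplex g hgc hgm
  refine ⟨p l, hpmem hl, ?_⟩
  have hpos := hwpos _ (hpT l hl)
  have h1 : L (p l) - L (N (p l)) = ∑ j, l j • (L (t j) - L (N (p l))) := by
    simp only [smul_sub, Finset.sum_sub_distrib, ← Finset.sum_smul, hl.2, one_smul]
    simp [hp]
  rw [h1]
  calc ‖∑ j, l j • (L (t j) - L (N (p l)))‖ ≤ ∑ j, l j * ε := by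
        refine norm_sum_le_of_le _ fun j _ => ?_
        rw [norm_smul, Real.norm_of_nonneg (hl.1 j)]
        rcases (hl.1 j).eq_or_lt with h0 | h0
        · rw [← h0]; simp
        · refine mul_le_mul_of_nonneg_left ?_ h0.le
          rw [← congrFun hgl j] at h0
          have h2 : 0 < w (L (N (p l))) j := by
            by_contra hcon
            have : w (L (N (p l))) j = 0 := le_antisymm (not_lt.1 hcon) (hw0 _ j)
            simp [hg, this] at h0
          have h3 : 0 < ε - ‖L (N (p l)) - L (t j)‖ := by
            by_contra hcon
            exact h2.ne' (max_eq_left (not_lt.1 hcon))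
          rw [norm_sub_rev]
          linarith
    _ = ε := by rw [← Finset.sum_mul, hl.2, one_mul]

/-- **Krein's theorem**, in a sequential form: if every sequence of `T` has a weakly convergent
subsequence, then on the convex hull of `T` weak convergence of a sequence can be tested on a
separating sequence of functionals. -/
theorem weakConv_of_mem_convexHull {E : Type*} [NormedAddCommGroup E] [NormedSpace ℝ E]
    [CompleteSpace E] {D T : Set E} (hD : D.Countable) (hconv : Convex ℝ (closure D))
    (hbdd : Bornology.IsBounded (closure D)) (hTD : T ⊆ closure D)
    (hT : ∀ u : ℕ → E, (∀ n, u n ∈ T) →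
      ∃ φ : ℕ → ℕ, StrictMono φ ∧ ∃ x : E, WeakConv (fun n => u (φ n)) x)
    {F : ℕ → E →L[ℝ] ℝ}
    (hF : ∀ x ∈ closure D, ∀ y ∈ closure D, (∀ i, F i x = F i y) → x = y)
    {x : ℕ → E} {t : E} (hx : ∀ n, x n ∈ convexHull ℝ T) (ht : t ∈ closure D)
    (hFx : ∀ i, Tendsto (fun n => F i (x n)) atTop (𝓝 (F i t))) : WeakConv x t := by
  obtain ⟨R, hR⟩ := hbdd.exists_norm_le
  set Φ : E → ℕ → ℝ := fun x i => F i x with hΦ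
  set Q : Set (ℕ → ℝ) := closure (Φ '' T) with hQ
  have hQc : IsCompact Q := by
    refine (isCompact_univ_pi fun i =>
      isCompact_Icc (a := -(‖F i‖ * R)) (b := ‖F i‖ * R)).closure_of_subset ?_
    rintro _ ⟨x, hx, rfl⟩ i -
    refine abs_le.1 (((F i).le_opNorm x).trans ?_)
    gcongr
    exact hR x (hTD hx)
  have : CompactSpace Q := isCompact_iff_compactSpace.1 hQc
  have hσ : ∀ q : Q, ∃ z ∈ closure D, Φ z = q ∧ ∃ s : ℕ → E, (∀ n, s n ∈ T) ∧ WeakConv s z := by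
    rintro ⟨q, hq⟩
    obtain ⟨v, hv, hvq⟩ := mem_closure_iff_seq_limit.1 hq
    choose s hsT hs using hv
    obtain ⟨φ, hφ, z, hz⟩ := hT s hsT
    refine ⟨z, hz.mem_of_isClosed_of_convex isClosed_closure hconv fun n => hTD (hsT _), ?_,
      _, fun n => hsT (φ n), hz⟩
    funext i
    refine tendsto_nhds_unique (hz (F i)) ?_
    have h := ((tendsto_pi_nhds.1 hvq) i).comp hφ.tendsto_atTop
    refine h.congr fun n => ?_
    simp [← hs, hΦ]
  choose σ hσD hσΦ s hsT hs using hσ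
  have hσf : ∀ f : E →L[ℝ] ℝ, Continuous fun q => f (σ q) := by
    intro f
    refine SeqContinuous.continuous fun v q hvq => tendsto_of_subseq_tendsto fun ns hns => ?_
    have hex : ∀ n, ∃ a ∈ T, (∀ i ∈ Finset.range n, dist (F i a) ((v (ns n)).1 i) < 1 / (n + 1)) ∧
        dist (f a) (f (σ (v (ns n)))) < 1 / (n + 1) := by
      intro n
      have hpos : (0 : ℝ) < 1 / (n + 1) := by positivity
      have h1 : ∀ᶠ k in atTop, ∀ i ∈ Finset.range n,
          dist (F i (s (v (ns n)) k)) ((v (ns n)).1 i) < 1 / (n + 1) := by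
        refine (Finset.eventually_all _).2 fun i _ => ?_
        have h := hs (v (ns n)) (F i)
        rw [show F i (σ (v (ns n))) = (v (ns n)).1 i from congrFun (hσΦ _) i] at h
        exact (Metric.tendsto_nhds.1 h) _ hpos
      obtain ⟨k, hk1, hk2⟩ := (h1.and ((Metric.tendsto_nhds.1 (hs (v (ns n)) f)) _ hpos)).exists
      exact ⟨_, hsT _ k, hk1, hk2⟩
    choose a haT haF haf using hex
    obtain ⟨φ, hφ, z, hz⟩ := hT a haT
    have hzD : z ∈ closure D :=
      hz.mem_of_isClosed_of_convex isClosed_closure hconv fun n => hTD (haT _)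
    have hone : Tendsto (fun n => (1 : ℝ) / ((φ n : ℕ) + 1)) atTop (𝓝 0) :=
      tendsto_one_div_add_atTop_nhds_zero_nat.comp hφ.tendsto_atTop
    have hvq' : Tendsto (fun n => v (ns (φ n))) atTop (𝓝 q) :=
      hvq.comp (hns.comp hφ.tendsto_atTop)
    have hzq : z = σ q := by
      refine hF _ hzD _ (hσD q) fun i => ?_
      rw [show F i (σ q) = q.1 i from congrFun (hσΦ _) i]
      refine tendsto_nhds_unique (hz (F i)) ?_
      have h1 : Tendsto (fun n => (v (ns (φ n))).1 i) atTop (𝓝 (q.1 i)) :=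
        (((continuous_apply i).comp continuous_subtype_val).tendsto q).comp hvq'
      refine h1.congr_dist (squeeze_zero' (Eventually.of_forall fun n => dist_nonneg) ?_ hone)
      filter_upwards [eventually_gt_atTop i] with n hn
      rw [dist_comm]
      exact (haF _ i (Finset.mem_range.2 (hn.trans_le (hφ.le_apply)))).le
    refine ⟨φ, ?_⟩
    have h1 := hz f
    rw [hzq] at h1
    exact h1.congr_dist (squeeze_zero (fun n => dist_nonneg) (fun n => (haf _).le) hone)
  borelize E
  have hσball : ∀ (d : E) (r : ℝ), MeasurableSet {q | σ q ∈ Metric.closedBall d r} := by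
    intro d r
    have : {q | σ q ∈ Metric.closedBall d r} =
        ⋂ f : {f : E →L[ℝ] ℝ // ‖f‖ ≤ 1}, {q | f.1 (σ q) - f.1 d ≤ r} := by
      ext q
      simp only [Set.mem_ofPred_eq, Set.mem_iInter, Metric.mem_closedBall, dist_eq_norm]
      constructor
      · rintro h ⟨f, hf⟩
        rw [← map_sub]
        refine (le_abs_self _).trans ((f.le_opNorm _).trans (le_trans ?_ h))
        exact mul_le_of_le_one_left (norm_nonneg _) hf
      · intro h
        obtain ⟨f, hf1, hf⟩ := exists_dual_vector'' ℝ (σ q - d)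
        have := h ⟨f, hf1⟩
        rw [← map_sub, hf] at this
        simpa using this
    rw [this]
    exact (isClosed_iInter fun f : {f : E →L[ℝ] ℝ // ‖f‖ ≤ 1} => isClosed_le ((hσf f.1).sub
      continuous_const) continuous_const).measurableSet
  have hσm : MeasureTheory.StronglyMeasurable σ := by
    refine stronglyMeasurable_iff_measurable_separable.2 ⟨measurable_of_isOpen fun U hU => ?_, ?_⟩
    · have : σ ⁻¹' U = ⋃ p ∈ {p : E × ℚ | p.1 ∈ D ∧ Metric.closedBall p.1 p.2 ⊆ U},
          {q | σ q ∈ Metric.closedBall p.1 (p.2 : ℝ)} := by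
        ext q
        simp only [Set.mem_preimage, Set.mem_iUnion, Set.mem_ofPred_eq]
        constructor
        · intro hq
          obtain ⟨ε, hε, hεU⟩ := Metric.isOpen_iff.1 hU _ hq
          obtain ⟨r, hr0, hr⟩ := exists_rat_btwn (half_pos hε)
          obtain ⟨d, hd, hqd⟩ := Metric.mem_closure_iff.1 (hσD q) r hr0
          refine ⟨(d, r), ⟨hd, fun y hy => hεU ?_⟩, hqd.le⟩
          have h1 : dist y d ≤ r := hy
          have h2 := dist_triangle_right y (σ q) d
          rw [Metric.mem_ball]
          linarith
        · rintro ⟨p, ⟨-, hp⟩, hq⟩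
          exact hp hq
      rw [this]
      refine MeasurableSet.biUnion ?_ fun p _ => hσball p.1 p.2
      refine (hD.prod (Set.countable_univ (α := ℚ))).mono ?_
      rintro p ⟨hp, -⟩
      exact ⟨hp, trivial⟩
    · exact hD.isSeparable.closure.mono (Set.range_subset_iff.2 hσD)
  have hσi : ∀ (μ : MeasureTheory.Measure Q) [MeasureTheory.IsProbabilityMeasure μ],
      MeasureTheory.Integrable σ μ := fun μ _ =>
    MeasureTheory.Integrable.of_bound hσm.aestronglyMeasurable R
      (Eventually.of_forall fun q => hR _ (hσD q))
  have hrep : ∀ y ∈ convexHull ℝ T, ∃ μ : MeasureTheory.ProbabilityMeasure Q,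
      ∀ f : E →L[ℝ] ℝ, ∫ q, f (σ q) ∂(μ : MeasureTheory.Measure Q) = f y := by
    intro y hy
    refine convexHull_min (t := {y | ∃ μ : MeasureTheory.ProbabilityMeasure Q,
      ∀ f : E →L[ℝ] ℝ, ∫ q, f (σ q) ∂(μ : MeasureTheory.Measure Q) = f y}) ?_ ?_ hy
    · intro y hy
      have hq : Φ y ∈ Q := subset_closure ⟨y, hy, rfl⟩
      refine ⟨⟨MeasureTheory.Measure.dirac ⟨Φ y, hq⟩, inferInstance⟩, fun f => ?_⟩
      have h1 : σ ⟨Φ y, hq⟩ = y :=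
        hF _ (hσD _) _ (hTD hy) fun i => congrFun (hσΦ ⟨Φ y, hq⟩) i
      simp [h1]
    · rintro y ⟨μ, hμ⟩ z ⟨ν, hν⟩ a b ha hb hab
      have hprob : MeasureTheory.IsProbabilityMeasure
          (ENNReal.ofReal a • (μ : MeasureTheory.Measure Q) +
            ENNReal.ofReal b • (ν : MeasureTheory.Measure Q)) := by
        constructor
        simp [← ENNReal.ofReal_add ha hb, hab]
      refine ⟨⟨_, hprob⟩, fun f => ?_⟩
      have hi : ∀ (ρ : MeasureTheory.ProbabilityMeasure Q) (c : ℝ),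
          MeasureTheory.Integrable (fun q => f (σ q))
            (ENNReal.ofReal c • (ρ : MeasureTheory.Measure Q)) := fun ρ c =>
        (f.integrable_comp (hσi ρ)).smul_measure ENNReal.ofReal_ne_top
      change ∫ q, f (σ q) ∂(ENNReal.ofReal a • (μ : MeasureTheory.Measure Q) +
            ENNReal.ofReal b • (ν : MeasureTheory.Measure Q)) = _
      rw [MeasureTheory.integral_add_measure (hi μ a) (hi ν b), MeasureTheory.integral_smul_measure,
        MeasureTheory.integral_smul_measure, hμ, hν, ENNReal.toReal_ofReal ha,
        ENNReal.toReal_ofReal hb]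
      simp
  choose m hm using fun n => hrep _ (hx n)
  intro f
  refine (tendsto_iff_ultrafilter _ _ _).2 fun g hg => ?_
  obtain ⟨ν, hν⟩ : ∃ ν, Tendsto m g (𝓝 ν) := ⟨_, (Ultrafilter.map m g).le_nhds_lim⟩
  have hlim : ∀ h : E →L[ℝ] ℝ, Tendsto (fun n => h (x n)) g
      (𝓝 (h (∫ q, σ q ∂(ν : MeasureTheory.Measure Q)))) := by
    intro h
    have h1 := (MeasureTheory.ProbabilityMeasure.tendsto_iff_forall_integral_tendsto.1 hν)
      (BoundedContinuousFunction.mkOfCompact ⟨_, hσf h⟩)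
    rw [← h.integral_comp_comm (hσi _)]
    exact h1.congr fun n => hm n h
  have hb : ∫ q, σ q ∂(ν : MeasureTheory.Measure Q) ∈ closure D :=
    hconv.integral_mem isClosed_closure (Eventually.of_forall hσD) (hσi _)
  have hbt := hF _ hb _ ht fun i => tendsto_nhds_unique (hlim (F i)) ((hFx i).mono_left hg)
  rw [← hbt]
  exact hlim f

/-- A weakly sequentially continuous self-map of a nonempty bounded closed convex set, every
sequence of whose range has a weakly convergent subsequence, has a fixed point. -/
theorem exists_fixedPoint_of_weakConv {E : Type*} [NormedAddCommGroup E] [NormedSpace ℝ E]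
    [CompleteSpace E] {S : Set E} (hne : S.Nonempty) (hbdd : Bornology.IsBounded S)
    (hcl : IsClosed S) (hconv : Convex ℝ S) {N : E → E} (hmaps : Set.MapsTo N S S)
    (hN : ∀ (u : ℕ → E) (x : E), (∀ n, u n ∈ S) → x ∈ S → WeakConv u x →
      WeakConv (fun n => N (u n)) (N x))
    (hT : ∀ u : ℕ → E, (∀ n, u n ∈ S) →
      ∃ φ : ℕ → ℕ, StrictMono φ ∧ ∃ x : E, WeakConv (fun n => N (u (φ n))) x) :
    ∃ x ∈ S, N x = x := by
  obtain ⟨D, hD, hDne, hDS, hDconv, hDN⟩ := exists_separable_invariant hne hcl hconv hmaps hN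
  obtain ⟨F, hF⟩ := exists_seq_clm_separating hD
  set T := N '' closure D with hTdef
  have hTD : T ⊆ closure D := hDN.image_subset
  have hcT : convexHull ℝ T ⊆ closure D := convexHull_min hTD hDconv
  have hDb : Bornology.IsBounded (closure D) := hbdd.subset hDS
  have happrox : ∀ n : ℕ, ∃ x ∈ convexHull ℝ T,
      ∀ i < n, dist (F i x) (F i (N x)) ≤ 1 / ((n : ℝ) + 1) := by
    intro n
    set L : E →L[ℝ] (Fin n → ℝ) := ContinuousLinearMap.pi fun i : Fin n => F i with hL
    have hLN : ContinuousOn (fun y => L (N y)) (convexHull ℝ T) := by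
      refine continuousOn_pi.2 fun i y hy => tendsto_of_seq_tendsto fun u hu => ?_
      rw [tendsto_nhdsWithin_iff] at hu
      obtain ⟨k, hk⟩ := eventually_atTop.1 hu.2
      rw [← tendsto_add_atTop_iff_nat k]
      exact hN (fun n => u (n + k)) y (fun n => hDS (hcT (hk _ (Nat.le_add_left _ _))))
        (hDS (hcT hy)) (WeakConv.of_tendsto ((tendsto_add_atTop_iff_nat k).2 hu.1)) (F i)
    have hLT : TotallyBounded (L '' T) :=
      (L.lipschitz.isBounded_image (hDb.subset hTD)).isCompact_closure.totallyBounded.subset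
        subset_closure
    obtain ⟨x, hx, hxL⟩ := exists_approx_fixedPoint (hDne.closure.image N) L hLT
      (fun y hy => ⟨y, hcT hy, rfl⟩) hLN (ε := 1 / ((n : ℝ) + 1)) (by positivity)
    refine ⟨x, hx, fun i hi => ?_⟩
    rw [← dist_eq_norm] at hxL
    exact (dist_le_pi_dist (L x) (L (N x)) ⟨i, hi⟩).trans hxL
  choose x hxT hxF using happrox
  obtain ⟨φ, hφ, t, ht⟩ := hT x fun n => hDS (hcT (hxT n))
  have htD : t ∈ closure D := ht.mem_of_isClosed_of_convex isClosed_closure hDconv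
    fun n => hDN (hcT (hxT _))
  have hone : Tendsto (fun n => (1 : ℝ) / ((φ n : ℕ) + 1)) atTop (𝓝 0) :=
    tendsto_one_div_add_atTop_nhds_zero_nat.comp hφ.tendsto_atTop
  have hxt : WeakConv (fun n => x (φ n)) t := by
    refine weakConv_of_mem_convexHull hD hDconv hDb hTD ?_ hF (fun n => hxT _) htD fun i => ?_
    · intro u hu
      choose v hvD hv using hu
      obtain ⟨ψ, hψ, z, hz⟩ := hT v fun n => hDS (hvD n)
      exact ⟨ψ, hψ, z, by simpa only [hv] using hz⟩
    · refine (ht (F i)).congr_dist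
        (squeeze_zero' (Eventually.of_forall fun n => dist_nonneg) ?_ hone)
      filter_upwards [eventually_gt_atTop i] with n hn
      rw [dist_comm]
      exact hxF _ i (hn.trans_le hφ.le_apply)
  exact ⟨t, hDS htD, (hN _ t (fun n => hDS (hcT (hxT _))) (hDS htD) hxt).unique ht⟩

/-- hybrid fixed point theorem for `x = A x · B x + C x` in a real Banach
algebra with identity satisfying condition (P), where `A(S)` and `B(S)` are relatively
weakly compact and `I - C` satisfies a weak subsequential compactness condition. -/
theorem hybrid_fixedPoint_of_weaklyCompact_A_B {X : Type*} [NormedRing X]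
    [NormedAlgebra ℝ X] [CompleteSpace X] (hP : CondP X)
    (S : Set X) (hne : S.Nonempty) (hbdd : Bornology.IsBounded S)
    (hcl : IsClosed S) (hconv : Convex ℝ S)
    (A B C : X → X)
    (hAwsc : ∀ (u : ℕ → X) (x : X), (∀ n, u n ∈ S) → x ∈ S →
      WeakConv u x → WeakConv (fun n => A (u n)) (A x))
    (hBwsc : ∀ (u : ℕ → X) (x : X), (∀ n, u n ∈ S) → x ∈ S →
      WeakConv u x → WeakConv (fun n => B (u n)) (B x))
    (hCwsc : ∀ (u : ℕ → X) (x : X), (∀ n, u n ∈ S) → x ∈ S →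
      WeakConv u x → WeakConv (fun n => C (u n)) (C x))
    (hAreg : ∀ x ∈ S, IsUnit (A x))
    (hAcomp : RelWeaklyCompact (A '' S))
    (hBcomp : RelWeaklyCompact (B '' S))
    (hIC : ∀ (u : ℕ → X), (∀ n, u n ∈ S) →
      (∃ z : X, WeakConv (fun n => u n - C (u n)) z) →
      ∃ φ : ℕ → ℕ, StrictMono φ ∧ ∃ x : X, WeakConv (fun n => u (φ n)) x)
    (hinv : ∀ y ∈ S, ∃! x, x ∈ S ∧ x = A x * B y + C x) :
    ∃ x ∈ S, x = A x * B x + C x := by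
  choose! N hNmem hNuniq using hinv
  have hNS : ∀ y ∈ S, N y ∈ S := fun y hy => (hNmem y hy).1
  have hNeq : ∀ y ∈ S, N y = A (N y) * B y + C (N y) := fun y hy => (hNmem y hy).2
  have hIN : ∀ y ∈ S, N y - C (N y) = A (N y) * B y := fun y hy =>
    sub_eq_of_eq_add (hNeq y hy)
  have hT : ∀ u : ℕ → X, (∀ n, u n ∈ S) →
      ∃ φ : ℕ → ℕ, StrictMono φ ∧ ∃ x : X, WeakConv (fun n => N (u (φ n))) x := by
    intro u hu
    obtain ⟨φ, hφ, a, ha⟩ := hAcomp.exists_subseq (u := fun n => A (N (u n)))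
      fun n => ⟨_, hNS _ (hu n), rfl⟩
    obtain ⟨ψ, hψ, b, hb⟩ := hBcomp.exists_subseq (u := fun n => B (u (φ n)))
      fun n => ⟨_, hu _, rfl⟩
    obtain ⟨χ, hχ, x, hx⟩ := hIC (fun n => N (u (φ (ψ n)))) (fun n => hNS _ (hu _)) ⟨a * b, by
      simpa only [hIN _ (hu _)] using hP _ _ _ _ (ha.comp_strictMono hψ) hb⟩
    exact ⟨fun n => φ (ψ (χ n)), hφ.comp (hψ.comp hχ), x, hx⟩
  have hNwsc : ∀ (u : ℕ → X) (x : X), (∀ n, u n ∈ S) → x ∈ S → WeakConv u x →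
      WeakConv (fun n => N (u n)) (N x) := by
    intro u x hu hx hux f
    refine tendsto_of_subseq_tendsto fun ns hns => ?_
    have hux' : WeakConv (fun n => u (ns n)) x := fun f => (hux f).comp hns
    obtain ⟨φ, hφ, z, hz⟩ := hT (fun n => u (ns n)) fun n => hu _
    have hzS : z ∈ S := hz.mem_of_isClosed_of_convex hcl hconv fun n => hNS _ (hu _)
    have h1 : WeakConv (fun n => A (N (u (ns (φ n)))) * B (u (ns (φ n)))) (A z * B x) :=
      hP _ _ _ _ (hAwsc _ z (fun n => hNS _ (hu _)) hzS hz)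
        (hBwsc _ x (fun n => hu _) hx (hux'.comp_strictMono hφ))
    have h2 := hCwsc _ z (fun n => hNS _ (hu _)) hzS hz
    have h3 : WeakConv (fun n => N (u (ns (φ n)))) (A z * B x + C z) := by
      intro f
      rw [map_add]
      refine ((h1 f).add (h2 f)).congr fun n => ?_
      rw [← map_add, ← hNeq _ (hu _)]
    have hzN : z = N x := hNuniq x hx z ⟨hzS, hz.unique h3⟩
    exact ⟨φ, hzN ▸ hz f⟩
  obtain ⟨x, hx, hNx⟩ := exists_fixedPoint_of_weakConv hne hbdd hcl hconv hNS hNwsc hT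
  exact ⟨x, hx, by simpa only [hNx] using hNeq x hx⟩
end

section
/- Let X be a real Banach space and let C : X → X be weakly sequentially continuous and Lipschitz with constant c, 0 ≤ c < 1. If (x_n) is a bounded sequence in X such that the sequence (x_n − C x_n) converges weakly in X, then (x_n) admits a weakly convergent subsequence. -/
open Filter Topology Pointwise

variable {X : Type*} [NormedAddCommGroup X] [NormedSpace ℝ X]

theorem WeakConv.add {u v : ℕ → X} {x y : X} (hu : WeakConv u x) (hv : WeakConv v y) :
    WeakConv (fun n => u n + v n) (x + y) := fun f => by
  simpa only [map_add] using (hu f).add (hv f)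

/-- If `u` is a uniform norm limit of weakly convergent sequences whose weak limits converge in
norm, then `u` converges weakly to the limit of the weak limits. -/
theorem WeakConv.of_norm_sub_le {v : ℕ → ℕ → X} {a : ℕ → X} {u : ℕ → X} {x : X} {b : ℕ → ℝ}
    (hv : ∀ k, WeakConv (v k) (a k)) (ha : Tendsto a atTop (𝓝 x))
    (hb : Tendsto b atTop (𝓝 0)) (huv : ∀ k n, ‖u n - v k n‖ ≤ b k) : WeakConv u x := by
  intro f
  have hunif : TendstoUniformly (fun k n => f (v k n)) (fun n => f (u n)) atTop := by
    rw [Metric.tendstoUniformly_iff]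
    intro ε hε
    have hfb : Tendsto (fun k => ‖f‖ * b k) atTop (𝓝 0) := by simpa using hb.const_mul ‖f‖
    filter_upwards [hfb.eventually_lt_const hε] with k hk n
    calc dist (f (u n)) (f (v k n)) = ‖f (u n - v k n)‖ := by rw [dist_eq_norm, map_sub]
      _ ≤ ‖f‖ * ‖u n - v k n‖ := f.le_opNorm _
      _ ≤ ‖f‖ * b k := by gcongr; exact huv k n
      _ < ε := hk
  exact hunif.tendsto_of_eventually_tendsto
    (.of_forall fun k => hv k f) ((f.continuous.tendsto x).comp ha)

/-- The Picard iterates, started at `0`, of `x ↦ w + C x`. -/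
def picardIter {E : Type*} [AddMonoid E] (C : E → E) (w : E) : ℕ → E
  | 0 => 0
  | k + 1 => w + C (picardIter C w k)

theorem norm_sub_picardIter_le {E : Type*} [NormedAddCommGroup E] {C : E → E} {c : ℝ}
    (hc0 : 0 ≤ c)
    (hlip : ∀ x y : E, ‖C x - C y‖ ≤ c * ‖x - y‖) (x : E) (k : ℕ) :
    ‖x - picardIter C (x - C x) k‖ ≤ c ^ k * ‖x‖ := by
  induction k with
  | zero => simp [picardIter]
  | succ k ih =>
    calc ‖x - picardIter C (x - C x) (k + 1)‖
        = ‖C x - C (picardIter C (x - C x) k)‖ := by rw [picardIter]; congr 1; abel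
      _ ≤ c * ‖x - picardIter C (x - C x) k‖ := hlip _ _
      _ ≤ c * (c ^ k * ‖x‖) := by gcongr
      _ = c ^ (k + 1) * ‖x‖ := by ring

theorem cauchySeq_picardIter {E : Type*} [NormedAddCommGroup E] {C : E → E} {c : ℝ}
    (hc0 : 0 ≤ c) (hc1 : c < 1)
    (hlip : ∀ x y : E, ‖C x - C y‖ ≤ c * ‖x - y‖) (w : E) : CauchySeq (picardIter C w) := by
  refine cauchySeq_of_le_geometric c ‖picardIter C w 1‖ hc1 fun k => ?_
  induction k with
  | zero => simp [picardIter]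
  | succ k ih =>
    calc dist (picardIter C w (k + 1)) (picardIter C w (k + 1 + 1))
        = ‖C (picardIter C w k) - C (picardIter C w (k + 1))‖ := by
          rw [dist_eq_norm]; exact congrArg norm (add_sub_add_left_eq_sub ..)
      _ ≤ c * dist (picardIter C w k) (picardIter C w (k + 1)) := by
          rw [dist_eq_norm]; exact hlip _ _
      _ ≤ c * (‖picardIter C w 1‖ * c ^ k) := by gcongr
      _ = ‖picardIter C w 1‖ * c ^ (k + 1) := by ring

theorem WeakConv.picardIter {C : X → X}
    (hwsc : ∀ (u : ℕ → X) (x : X), WeakConv u x → WeakConv (fun n => C (u n)) (C x))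
    {w : ℕ → X} {z : X} (hw : WeakConv w z) (k : ℕ) :
    WeakConv (fun n => picardIter C (w n) k) (picardIter C z k) := by
  induction k with
  | zero => exact fun f => tendsto_const_nhds
  | succ k ih => exact hw.add (hwsc _ _ ih)

/-- if `C` is weakly sequentially continuous and Lipschitz with constant
`0 ≤ c < 1` on a real Banach space, and `(x_n - C x_n)` converges weakly for a bounded
sequence `(x_n)`, then `(x_n)` has a weakly convergent subsequence. -/
theorem weakly_convergent_subsequence_of_I_sub_C {X : Type*} [NormedAddCommGroup X]
    [NormedSpace ℝ X] [CompleteSpace X] (C : X → X) (c : ℝ) (hc0 : 0 ≤ c) (hc1 : c < 1)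
    (hwsc : ∀ (u : ℕ → X) (x : X), WeakConv u x → WeakConv (fun n => C (u n)) (C x))
    (hlip : ∀ x y : X, ‖C x - C y‖ ≤ c * ‖x - y‖)
    (u : ℕ → X) (hbdd : Bornology.IsBounded (Set.range u))
    (z : X) (hconv : WeakConv (fun n => u n - C (u n)) z) :
    ∃ φ : ℕ → ℕ, StrictMono φ ∧ ∃ x : X, WeakConv (fun n => u (φ n)) x := by
  obtain ⟨M, hM⟩ := hbdd.exists_norm_le
  obtain ⟨x, hx⟩ := cauchySeq_tendsto_of_complete (cauchySeq_picardIter hc0 hc1 hlip z)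
  have hb : Tendsto (fun k => c ^ k * M) atTop (𝓝 0) := by
    simpa using (tendsto_pow_atTop_nhds_zero_of_lt_one hc0 hc1).mul_const M
  refine ⟨id, strictMono_id, x,
    WeakConv.of_norm_sub_le (fun k => hconv.picardIter hwsc k) hx hb fun k n => ?_⟩
  calc ‖u n - picardIter C (u n - C (u n)) k‖ ≤ c ^ k * ‖u n‖ :=
        norm_sub_picardIter_le hc0 hlip _ k
    _ ≤ c ^ k * M := by gcongr; exact hM _ (Set.mem_range_self n)
end
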